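/- For every KAT expression e, every atom α, and every action symbol p, the derivative of the guarded-string language of e with respect to αp equals the guarded-string language of the set of partial derivatives: D_{αp}(GS(e)) = GS(Δ_{αp}(e)). -/

import Mathlib

namespace KAT

variable {T A : Type} [DecidableEq A]

/-- Atoms: truth assignments to the primitive tests. -/
abbrev Atom (T : Type) := T → Bool

/-- A guarded string `α₁p₁α₂p₂⋯p_{n-1}αₙ`, as the list of (atom, action)
pairs together with the final atom. -/
structure GStr (T A : Type) where
  pairs : List (Atom T × A)
  last : Atom T

/-- The first atom of a guarded string. -/
def GStr.first (x : GStr T A) : Atom T :=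
  match x.pairs with
  | [] => x.last
  | (α, _) :: _ => α

/-- Fusion product on sets of guarded strings. -/
def fprod (X Y : Set (GStr T A)) : Set (GStr T A) :=
  {z | ∃ x ∈ X, ∃ y ∈ Y, x.last = y.first ∧ z = ⟨x.pairs ++ y.pairs, y.last⟩}

/-- The set of atoms, viewed as guarded strings. -/
def atomsGS : Set (GStr T A) := {z | z.pairs = []}

/-- Fusion powers: `X⁰ = At`, `X^{n+1} = X ⋄ Xⁿ`. -/
def fpow (X : Set (GStr T A)) : ℕ → Set (GStr T A)
  | 0 => atomsGS
  | n + 1 => fprod X (fpow X n)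

/-- `X* = ∪ₙ Xⁿ`. -/
def fstar (X : Set (GStr T A)) : Set (GStr T A) := ⋃ n, fpow X n

/-- Derivative of a set of guarded strings w.r.t. `αp`. -/
def gderiv (α : Atom T) (p : A) (R : Set (GStr T A)) : Set (GStr T A) :=
  {y | (⟨(α, p) :: y.pairs, y.last⟩ : GStr T A) ∈ R}

/-- Boolean expressions over primitive tests `T`. -/
inductive BExp (T : Type) where
  | zero | one
  | test (t : T)
  | not (b : BExp T)
  | or (b₁ b₂ : BExp T)
  | and (b₁ b₂ : BExp T)

/-- Evaluation of a Boolean expression at an atom (`α ≤ b`). -/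
def BExp.eval (α : Atom T) : BExp T → Bool
  | .zero => false
  | .one => true
  | .test t => α t
  | .not b => !(b.eval α)
  | .or b₁ b₂ => b₁.eval α || b₂.eval α
  | .and b₁ b₂ => b₁.eval α && b₂.eval α

/-- KAT expressions over actions `Σ = A` and tests `T`. -/
inductive KExp (T A : Type) where
  | act (p : A)
  | test (b : BExp T)
  | plus (e₁ e₂ : KExp T A)
  | cat (e₁ e₂ : KExp T A)
  | star (e : KExp T A)

/-- Guarded-string semantics of a KAT expression. -/
def gs : KExp T A → Set (GStr T A)
  | .act p => {z | ∃ α β, z = ⟨[(α, p)], β⟩}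
  | .test b => {z | z.pairs = [] ∧ b.eval z.last = true}
  | .plus e₁ e₂ => gs e₁ ∪ gs e₂
  | .cat e₁ e₂ => fprod (gs e₁) (gs e₂)
  | .star e => fstar (gs e)

/-- Syntactic evaluation `E_α`. -/
def Eps (α : Atom T) : KExp T A → Bool
  | .act _ => false
  | .test b => b.eval α
  | .plus e₁ e₂ => Eps α e₁ || Eps α e₂
  | .cat e₁ e₂ => Eps α e₁ && Eps α e₂
  | .star _ => true

/-- `Γ · e`, with `Γ·0 = ∅` and `Γ·1 = Γ`. -/
def prodSet (Γ : Set (KExp T A)) : KExp T A → Set (KExp T A)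
  | .test .zero => ∅
  | .test .one => Γ
  | e => {x | ∃ e' ∈ Γ, x = .cat e' e}

/-- Partial derivatives `Δ_{αp}(e)`. -/
def pd (α : Atom T) (p : A) : KExp T A → Set (KExp T A)
  | .act p' => if p = p' then {.test .one} else ∅
  | .test _ => ∅
  | .plus e₁ e₂ => pd α p e₁ ∪ pd α p e₂
  | .cat e₁ e₂ => prodSet (pd α p e₁) e₂ ∪ (if Eps α e₁ then pd α p e₂ else ∅)
  | .star e => prodSet (pd α p e) (.star e)

/-- Guarded-string semantics of a set of expressions. -/
def gsSet (E : Set (KExp T A)) : Set (GStr T A) := ⋃ e ∈ E, gs e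

/-- Partial derivative of a set of expressions. -/
def pdS (α : Atom T) (p : A) (E : Set (KExp T A)) : Set (KExp T A) :=
  ⋃ e ∈ E, pd α p e

/-- Iterated partial derivative `Δ̂_w(e)` along a word `w ∈ (At·Σ)*`. -/
def pdWord (w : List (Atom T × A)) (e : KExp T A) : Set (KExp T A) :=
  w.foldl (fun E x => pdS x.1 x.2 E) {e}

/-- The closure `PD(e)`. -/
def PD : KExp T A → Set (KExp T A)
  | .test b => {.test b}
  | .act p => {.act p, .test .one}
  | .plus e₁ e₂ => {.plus e₁ e₂} ∪ PD e₁ ∪ PD e₂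
  | .cat e₁ e₂ => {.cat e₁ e₂} ∪ prodSet (PD e₁) e₂ ∪ PD e₂
  | .star e => {.star e} ∪ prodSet (PD e) (.star e)

/-- Number of symbols in the syntactic tree of a Boolean expression. -/
def BExp.size : BExp T → ℕ
  | .zero => 1 | .one => 1 | .test _ => 1
  | .not b => b.size + 1
  | .or b₁ b₂ => b₁.size + b₂.size + 1
  | .and b₁ b₂ => b₁.size + b₂.size + 1

/-- Number of symbols in the syntactic tree of a KAT expression. -/
def KExp.size : KExp T A → ℕ
  | .act _ => 1
  | .test b => b.size
  | .plus e₁ e₂ => e₁.size + e₂.size + 1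
  | .cat e₁ e₂ => e₁.size + e₂.size + 1
  | .star e => e.size + 1

/-- A set of assumptions `Γ`: equations `b p b̄' = 0` and inequalities `c ≤ c'`. -/
structure Gamma (T A : Type) where
  eqns : List (BExp T × A × BExp T)
  ineqs : List (BExp T × BExp T)

/-- `α ∈ At^Γ`. -/
def inAtG (G : Gamma T A) (α : Atom T) : Bool :=
  G.ineqs.all fun cc => !(cc.1.eval α) || cc.2.eval α

/-- The atoms of `At^Γ`, viewed as guarded strings. -/
def atomsG (G : Gamma T A) : Set (GStr T A) := {z | z.pairs = [] ∧ inAtG G z.last = true}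

/-- Γ-restricted fusion powers (base case `At^Γ`). -/
def fpowG (G : Gamma T A) (X : Set (GStr T A)) : ℕ → Set (GStr T A)
  | 0 => atomsG G
  | n + 1 => fprod X (fpowG G X n)

def fstarG (G : Gamma T A) (X : Set (GStr T A)) : Set (GStr T A) := ⋃ n, fpowG G X n

/-- The Γ-restricted guarded-string semantics `GS^Γ`. -/
def gsG (G : Gamma T A) : KExp T A → Set (GStr T A)
  | .act p => {z | ∃ α β, inAtG G α = true ∧ inAtG G β = true ∧
      (∀ x ∈ G.eqns, x.2.1 = p → x.1.eval α = true → x.2.2.eval β = true) ∧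
      z = ⟨[(α, p)], β⟩}
  | .test b => {z | z.pairs = [] ∧ inAtG G z.last = true ∧ b.eval z.last = true}
  | .plus e₁ e₂ => gsG G e₁ ∪ gsG G e₂
  | .cat e₁ e₂ => fprod (gsG G e₁) (gsG G e₂)
  | .star e => fstarG G (gsG G e)

def gsSetG (G : Gamma T A) (E : Set (KExp T A)) : Set (GStr T A) := ⋃ e ∈ E, gsG G e

/-- Sum of a list of KAT expressions. -/
def sumList (l : List (KExp T A)) : KExp T A := l.foldr .plus (.test .zero)

/-- The universal expression `u = (p₁ + ⋯ + p_k)*`. -/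
def uExp (ps : List A) : KExp T A := .star (sumList (ps.map .act))

/-- `r = Σᵢ bᵢpᵢb̄ᵢ' + Σⱼ cⱼc̄ⱼ'`. -/
def rExp (G : Gamma T A) : KExp T A :=
  sumList
    (G.eqns.map (fun x => .cat (.cat (.test x.1) (.act x.2.1)) (.test (.not x.2.2))) ++
     G.ineqs.map (fun x => .cat (.test x.1) (.test (.not x.2))))

/-- The expression `u r u`. -/
def uru (G : Gamma T A) (ps : List A) : KExp T A :=
  .cat (.cat (uExp ps) (rExp G)) (uExp ps)

/-- `Π{b' | (b p b̄' = 0) ∈ Γ, α ≤ b}` (equal to `1` if there are none). -/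
def gammaProd (G : Gamma T A) (α : Atom T) (p : A) : BExp T :=
  ((G.eqns.filter fun x => decide (x.2.1 = p) && x.1.eval α).map fun x => x.2.2).foldr .and .one

def pdGaux (G : Gamma T A) (α : Atom T) (p : A) : KExp T A → Set (KExp T A)
  | .act p' => if p = p' then {.test (gammaProd G α p)} else ∅
  | .test _ => ∅
  | .plus e₁ e₂ => pdGaux G α p e₁ ∪ pdGaux G α p e₂
  | .cat e₁ e₂ => prodSet (pdGaux G α p e₁) e₂ ∪ (if Eps α e₁ then pdGaux G α p e₂ else ∅)
  | .star e => prodSet (pdGaux G α p e) (.star e)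

/-- The Γ-partial derivative `Δ^Γ_{αp}(e)`. -/
def pdG (G : Gamma T A) (α : Atom T) (p : A) (e : KExp T A) : Set (KExp T A) :=
  if inAtG G α then pdGaux G α p e else ∅

/-- The atoms occurring in a guarded string. -/
def atomsOf (x : GStr T A) : List (Atom T) := x.pairs.map Prod.fst ++ [x.last]

/-- The substrings `α p β` of a guarded string. -/
def triplesOf (x : GStr T A) : List (Atom T × A × Atom T) :=
  List.zipWith (fun ap β => (ap.1, ap.2, β)) x.pairs
    ((x.pairs.map Prod.fst).drop 1 ++ [x.last])

/-- `Γ·e` on transition pairs, with `Γ·0 = ∅` and `Γ·1 = Γ`. -/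
def prodPairs (Γ : Set ((Atom T × A) × KExp T A)) :
    KExp T A → Set ((Atom T × A) × KExp T A)
  | .test .zero => ∅
  | .test .one => Γ
  | e => {x | ∃ y ∈ Γ, x = (y.1, .cat y.2 e)}

/-- The transition function `𝖿`. -/
def fset : KExp T A → Set ((Atom T × A) × KExp T A)
  | .act p => {x | ∃ α : Atom T, x = ((α, p), .test .one)}
  | .test _ => ∅
  | .plus e₁ e₂ => fset e₁ ∪ fset e₂
  | .cat e₁ e₂ => prodPairs (fset e₁) e₂ ∪ {x ∈ fset e₂ | Eps x.1.1 e₁ = true}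
  | .star e => prodPairs (fset e) (.star e)

/-- `der_{αp}(e) = {e' | (αp, e') ∈ 𝖿(e)}`. -/
def der (α : Atom T) (p : A) (e : KExp T A) : Set (KExp T A) :=
  {e' | ((α, p), e') ∈ fset e}

end KAT

namespace KAT

theorem mem_gsSet {T A : Type} (E : Set (KExp T A)) (z : GStr T A) :
    z ∈ gsSet E ↔ ∃ e ∈ E, z ∈ gs e := by
  simp [gsSet]

/-- Right unit law for fusion. -/
theorem fprod_one {T A : Type} (X : Set (GStr T A)) :
    fprod X (gs (.test .one)) = X := by
  ext z
  constructor
  · rintro ⟨⟨xs, a⟩, hx, ⟨ys, b⟩, ⟨hy, -⟩, h, rfl⟩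
    simp only at hy
    subst hy
    simp only [GStr.first] at h
    subst h
    simpa using hx
  · intro hz
    exact ⟨z, hz, ⟨[], z.last⟩, ⟨rfl, rfl⟩, rfl, by simp⟩

theorem gsSet_prodSet {T A : Type} (E : Set (KExp T A)) (e : KExp T A) :
    gsSet (prodSet E e) = fprod (gsSet E) (gs e) := by
  have key : gsSet {x | ∃ e' ∈ E, x = KExp.cat e' e} = fprod (gsSet E) (gs e) := by
    ext z
    simp only [mem_gsSet]
    constructor
    · rintro ⟨_, ⟨e', he, rfl⟩, x, hx, y, hy, h⟩
      exact ⟨x, (mem_gsSet _ _).2 ⟨e', he, hx⟩, y, hy, h⟩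
    · rintro ⟨x, hx, y, hy, h⟩
      obtain ⟨e', he, hx⟩ := (mem_gsSet _ _).1 hx
      exact ⟨_, ⟨e', he, rfl⟩, x, hx, y, hy, h⟩
  unfold prodSet
  split
  · ext z
    simp [gsSet, fprod, gs, BExp.eval]
  · rw [fprod_one]
  · exact key

theorem atom_mem_fprod {T A : Type} (X Y : Set (GStr T A)) (α : Atom T) :
    (⟨[], α⟩ : GStr T A) ∈ fprod X Y ↔
      (⟨[], α⟩ : GStr T A) ∈ X ∧ (⟨[], α⟩ : GStr T A) ∈ Y := by
  constructor
  · rintro ⟨⟨xs, a⟩, hx, ⟨ys, b⟩, hy, h, hz⟩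
    simp only [GStr.mk.injEq] at hz
    obtain ⟨h1, rfl⟩ := hz
    obtain ⟨rfl, rfl⟩ := List.append_eq_nil_iff.1 h1.symm
    simp only [GStr.first] at h
    subst h
    exact ⟨hx, hy⟩
  · rintro ⟨hx, hy⟩
    exact ⟨_, hx, _, hy, rfl, rfl⟩

theorem atom_mem_gs {T A : Type} (α : Atom T) (e : KExp T A) :
    (⟨[], α⟩ : GStr T A) ∈ gs e ↔ Eps α e = true := by
  induction e with
  | act p => simp [gs, Eps]
  | test b => simp [gs, Eps]
  | plus e f he hf => simp [gs, Eps, he, hf]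
  | cat e f he hf => simp [gs, Eps, atom_mem_fprod, he, hf]
  | star e he =>
    simp only [gs, Eps, fstar, Set.mem_iUnion, iff_true]
    exact ⟨0, rfl⟩

theorem mem_gderiv_fprod {T A : Type} (α : Atom T) (p : A) (X Y : Set (GStr T A))
    (z : GStr T A) : z ∈ gderiv α p (fprod X Y) ↔
      z ∈ fprod (gderiv α p X) Y ∨ ((⟨[], α⟩ : GStr T A) ∈ X ∧ z ∈ gderiv α p Y) := by
  obtain ⟨zs, c⟩ := z
  constructor
  · rintro ⟨⟨xs, a⟩, hx, ⟨ys, b⟩, hy, h, hz⟩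
    simp only [GStr.mk.injEq] at hz
    obtain ⟨h1, rfl⟩ := hz
    cases xs with
    | nil =>
      simp only [List.nil_append] at h1
      subst h1
      simp only [GStr.first] at h
      subst h
      exact Or.inr ⟨hx, hy⟩
    | cons q xs =>
      simp only [List.cons_append, List.cons.injEq] at h1
      obtain ⟨rfl, rfl⟩ := h1
      exact Or.inl ⟨⟨xs, a⟩, hx, ⟨ys, c⟩, hy, h, rfl⟩
  · rintro (⟨⟨xs, a⟩, hx, y, hy, h, hz⟩ | ⟨hx, hy⟩)
    · simp only [GStr.mk.injEq] at hz
      obtain ⟨rfl, rfl⟩ := hz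
      exact ⟨⟨(α, p) :: xs, a⟩, hx, y, hy, h, rfl⟩
    · exact ⟨_, hx, _, hy, rfl, rfl⟩

theorem gderiv_fstar {T A : Type} (α : Atom T) (p : A) (X : Set (GStr T A)) :
    gderiv α p (fstar X) = fprod (gderiv α p X) (fstar X) := by
  ext z
  constructor
  · intro hz
    obtain ⟨n, hn⟩ := Set.mem_iUnion.1 hz
    have hn' : z ∈ gderiv α p (fpow X n) := hn
    clear hn hz
    induction n with
    | zero => simp [gderiv, fpow, atomsGS] at hn'
    | succ n ih =>
      rcases (mem_gderiv_fprod α p _ _ z).1 hn' with ⟨x, hx, y, hy, h⟩ | ⟨-, h⟩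
      · exact ⟨x, hx, y, Set.mem_iUnion.2 ⟨n, hy⟩, h⟩
      · exact ih h
  · rintro ⟨x, hx, y, hy, h⟩
    obtain ⟨n, hn⟩ := Set.mem_iUnion.1 hy
    exact Set.mem_iUnion.2
      ⟨n + 1, (mem_gderiv_fprod α p X (fpow X n) z).2 (Or.inl ⟨x, hx, y, hn, h⟩)⟩

end KAT

open KAT in
/-- `D_{αp}(GS(e)) = GS(Δ_{αp}(e))`. -/
theorem gderiv_gs_eq_gsSet_pd {T A : Type} [DecidableEq A]
    (e : KExp T A) (α : Atom T) (p : A) :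
    gderiv α p (gs e) = gsSet (pd α p e) := by
  induction e with
  | act q =>
    ext ⟨zs, c⟩
    rw [mem_gsSet]
    by_cases h : p = q
    · simp [gderiv, gs, pd, h, BExp.eval]
    · simp [gderiv, gs, pd, h]
  | test b =>
    ext z
    simp [gderiv, gs, pd, gsSet]
  | plus e f he hf =>
    ext z
    have h1 := Set.ext_iff.1 he z
    have h2 := Set.ext_iff.1 hf z
    rw [mem_gsSet] at h1 h2 ⊢
    simp only [pd, Set.mem_union, or_and_right, exists_or, ← h1, ← h2]
    rfl
  | cat e f he hf =>
    ext z
    have h2 := Set.ext_iff.1 hf z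
    have h3 : z ∈ gsSet (pd α p (KExp.cat e f)) ↔
        z ∈ gsSet (prodSet (pd α p e) f) ∨ (Eps α e = true ∧ z ∈ gsSet (pd α p f)) := by
      simp only [mem_gsSet, pd, Set.mem_union, or_and_right, exists_or]
      by_cases h : Eps α e = true <;> simp [h]
    rw [h3, gsSet_prodSet, ← he, ← hf, ← atom_mem_gs]
    exact mem_gderiv_fprod α p _ _ z
  | star e he =>
    simp only [pd, gsSet_prodSet, ← he]
    exact gderiv_fstar α p _
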